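/- Assume Λ ⊆ ℂ is a compact q-invariant set on which q is uniformly expanding, and let A = g(Λ). Then the number ε₀ and the family of sets A_b with conjugacies Φ_b : Σ(A, H₀) → A_b (0 < |b| < ε₀) from the main conjugacy theorem can be chosen so that: (a) for every b₀ with 0 < |b₀| < ε₀, the map Θ defined on {b : 0 < |b| < ε₀} × A_{b₀} by Θ(b, Φ_{b₀}(w)) = Φ_b(w) for w ∈ Σ(A, H₀) is a holomorphic motion of A_{b₀} with base point b₀; and (b) A_b converges to A in the Hausdorff distance as b → 0. -/

import Mathlib

noncomputable section
open Set Metric Topology Filter ENNReal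

/-- The quadratic map `q(x) = x² + c`. -/
def qmap (c : ℂ) : ℂ → ℂ := fun x => x ^ 2 + c

/-- The Hénon map `H_b(x,y) = (x² + c − b·y, x)`; `H₀(x,y) = (q(x), x)`. -/
def henon (c b : ℂ) : ℂ × ℂ → ℂ × ℂ := fun p => (p.1 ^ 2 + c - b * p.2, p.1)

/-- `g(x) = (q(x), x)`. -/
def gmap (c : ℂ) : ℂ → ℂ × ℂ := fun x => (qmap c x, x)

/-- A set `S` is invariant under `f` if `f⁻¹(S) = S`. -/
def Invariant {α : Type*} (f : α → α) (S : Set α) : Prop := f ⁻¹' S = S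

/-- `Σ(S, f)`: bi-infinite orbit sequences of `f` lying in `S`, topologized as a
subspace of the product space `ℤ → X`. -/
def SigmaSet {X : Type*} (f : X → X) (S : Set X) : Set (ℤ → X) :=
  {z | (∀ i, z i ∈ S) ∧ ∀ i, f (z i) = z (i + 1)}

/-- The shift on bi-infinite sequences. -/
def shiftSeq {X : Type*} (z : ℤ → X) : ℤ → X := fun i => z (i + 1)

lemma shiftSeq_mem {X : Type*} {f : X → X} {S : Set X} {z : ℤ → X}
    (hz : z ∈ SigmaSet f S) : shiftSeq z ∈ SigmaSet f S :=
  ⟨fun i => hz.1 (i + 1), fun i => hz.2 (i + 1)⟩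

/-- The shift map `σ` as a self-map of `Σ(S, f)`. -/
def sigmaShift {X : Type*} (f : X → X) (S : Set X) :
    (SigmaSet f S) → (SigmaSet f S) :=
  fun z => ⟨shiftSeq z.1, shiftSeq_mem z.2⟩

/-- The inverse of the Hénon map (for `b ≠ 0`). -/
def henonInv (c b : ℂ) : ℂ × ℂ → ℂ × ℂ := fun p => (p.2, (p.2 ^ 2 + c - p.1) / b)

/-- `K(f)`: points with bounded forward orbit. -/
def Kset {E : Type*} [NormedAddCommGroup E] (f : E → E) : Set E :=
  {z | ∃ R : ℝ, ∀ n : ℕ, ‖f^[n] z‖ ≤ R}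

/-- `J(f) = ∂K(f)`. -/
def Jset {E : Type*} [NormedAddCommGroup E] (f : E → E) : Set E := frontier (Kset f)

/-- The Julia set `J(H_b) = J⁺(H_b) ∩ J⁻(H_b)` of the Hénon map. -/
def henonJulia (c b : ℂ) : Set (ℂ × ℂ) := Jset (henon c b) ∩ Jset (henonInv c b)

/-- A set `S` is uniformly expanding for `f : ℂ → ℂ`:
`∃ C > 0, λ > 1` with `|D(fⁿ)(z)| ≥ C·λⁿ` for all `z ∈ S`, `n ≥ 1`. -/
def IsExpandingOn (f : ℂ → ℂ) (S : Set ℂ) : Prop :=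
  ∃ C > 0, ∃ lam > 1, ∀ z ∈ S, ∀ n : ℕ, 1 ≤ n → C * lam ^ n ≤ ‖deriv (f^[n]) z‖

/-- Uniform hyperbolicity of a compact invariant set of a diffeomorphism `f`
(with inverse `finv`): a splitting `ℂ^k = Eˢ_z ⊕ Eᵘ_z` varying continuously with
`z` (encoded by the projection `P z` onto `Eˢ_z` along `Eᵘ_z`), invariant under
`Df`, with uniform contraction rates `(λ_s, λ_u)` on `Eˢ` under forward iterates
and on `Eᵘ` under backward iterates. -/
def IsHyperbolicSet {E : Type*} [NormedAddCommGroup E] [NormedSpace ℂ E]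
    (f finv : E → E) (S : Set E) : Prop :=
  ∃ (Es Eu : E → Submodule ℂ E) (P : E → E →L[ℂ] E) (Cs Cu lams lamu : ℝ),
    0 < Cs ∧ 0 < Cu ∧ 0 < lams ∧ lams < 1 ∧ 1 < lamu ∧
    ContinuousOn P S ∧
    (∀ z ∈ S, ∀ v : E, P z v ∈ Es z ∧ v - P z v ∈ Eu z) ∧
    (∀ z ∈ S, ∀ v ∈ Es z, P z v = v) ∧
    (∀ z ∈ S, ∀ v ∈ Eu z, P z v = 0) ∧
    (∀ z ∈ S, (Es z).map (fderiv ℂ f z).toLinearMap = Es (f z)) ∧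
    (∀ z ∈ S, (Eu z).map (fderiv ℂ f z).toLinearMap = Eu (f z)) ∧
    (∀ z ∈ S, ∀ n : ℕ, 1 ≤ n → ∀ v ∈ Es z, ‖fderiv ℂ (f^[n]) z v‖ ≤ Cs * lams ^ n * ‖v‖) ∧
    (∀ z ∈ S, ∀ n : ℕ, 1 ≤ n → ∀ v ∈ Eu z, ‖fderiv ℂ (finv^[n]) z v‖ ≤ Cu * (lamu ^ n)⁻¹ * ‖v‖)

/-- A holomorphic motion of `S ⊆ ℂ²` parameterized by `D ⊆ ℂ` with base point `b₀`. -/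
def IsHolomorphicMotion (D : Set ℂ) (b0 : ℂ) (S : Set (ℂ × ℂ))
    (Θ : ℂ → ℂ × ℂ → ℂ × ℂ) : Prop :=
  ContinuousOn (fun p : ℂ × (ℂ × ℂ) => Θ p.1 p.2) (D ×ˢ S) ∧
  (∀ w ∈ S, Θ b0 w = w) ∧
  (∀ b ∈ D, Set.InjOn (Θ b) S) ∧
  (∀ w ∈ S, DifferentiableOn ℂ (fun b => Θ b w) D)


/-- A contraction principle, in a weighted sup norm over `K`, for a class `Q` of functions
that is closed under uniform limits on `K`. -/
theorem exists_fixedPoint_of_weighted_contraction {P : Type*} (K : Set P) (W : P → ℝ)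
    (hW : ∀ p ∈ K, 1 ≤ W p) (Q : (P → ℂ) → Prop) (T : (P → ℂ) → P → ℂ) {κ : ℝ}
    (hκ₀ : 0 ≤ κ) (hκ : κ < 1) (hne : ∃ u, Q u) (hT : ∀ u, Q u → Q (T u))
    (hlim : ∀ (U : ℕ → P → ℂ) (u : P → ℂ), (∀ n, Q (U n)) →
      TendstoUniformlyOn U u atTop K → Q u)
    (hbdd : ∀ u v, Q u → Q v → ∃ d, ∀ p ∈ K, W p * ‖u p - v p‖ ≤ d)
    (hlip : ∀ u v d, Q u → Q v → (∀ p ∈ K, W p * ‖u p - v p‖ ≤ d) →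
      ∀ p ∈ K, W p * ‖T u p - T v p‖ ≤ κ * d) :
    ∃ u, Q u ∧ ∀ p ∈ K, T u p = u p := by
  obtain ⟨u₀, hu₀⟩ := hne
  set U : ℕ → P → ℂ := fun n => T^[n] u₀ with hU
  have hUs : ∀ n, U (n + 1) = T (U n) := fun n => Function.iterate_succ_apply' T n u₀
  have hQ : ∀ n, Q (U n) := by
    intro n
    induction n with
    | zero => exact hu₀
    | succ n ih => rw [hUs]; exact hT _ ih
  obtain ⟨d, hd⟩ := hbdd (U 0) (U 1) (hQ 0) (hQ 1)
  have hstep : ∀ n, ∀ p ∈ K, W p * ‖U n p - U (n + 1) p‖ ≤ κ ^ n * d := by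
    intro n
    induction n with
    | zero => simpa using hd
    | succ n ih =>
      intro p hp
      have := hlip _ _ _ (hQ n) (hQ (n + 1)) ih p hp
      rw [hUs n, hUs (n + 1), pow_succ']
      simpa [hUs, mul_assoc] using this
  have hdist : ∀ p ∈ K, ∀ n, dist (U n p) (U (n + 1) p) ≤ d / W p * κ ^ n := by
    intro p hp n
    have h0 : 0 < W p := one_pos.trans_le (hW p hp)
    have := hstep n p hp
    rw [dist_eq_norm, div_mul_eq_mul_div, le_div_iff₀ h0]
    linarith
  have hcau : ∀ p, ∃ l, p ∈ K → Tendsto (fun n => U n p) atTop (𝓝 l) := by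
    intro p
    by_cases hp : p ∈ K
    · obtain ⟨l, hl⟩ := cauchySeq_tendsto_of_complete
        (cauchySeq_of_le_geometric κ _ hκ (hdist p hp))
      exact ⟨l, fun _ => hl⟩
    · exact ⟨0, fun h => absurd h hp⟩
  choose u hu using hcau
  have htail : ∀ n, ∀ p ∈ K, W p * ‖U n p - u p‖ ≤ κ ^ n * (d / (1 - κ)) := by
    intro n p hp
    have h0 : 0 < W p := one_pos.trans_le (hW p hp)
    have h1 := dist_le_of_le_geometric_of_tendsto κ _ hκ (hdist p hp) (hu p hp) n
    rw [dist_eq_norm] at h1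
    calc W p * ‖U n p - u p‖ ≤ W p * (d / W p * κ ^ n / (1 - κ)) := by gcongr
      _ = κ ^ n * (d / (1 - κ)) := by
        field_simp
  have hzero : Tendsto (fun n => κ ^ n * (d / (1 - κ))) atTop (𝓝 0) := by
    simpa using (tendsto_pow_atTop_nhds_zero_of_lt_one hκ₀ hκ).mul_const (d / (1 - κ))
  have hunif : TendstoUniformlyOn U u atTop K := by
    rw [Metric.tendstoUniformlyOn_iff]
    intro e he
    filter_upwards [hzero.eventually_lt_const he] with n hn p hp
    rw [dist_comm, dist_eq_norm]
    have h1 := htail n p hp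
    have h2 := hW p hp
    nlinarith [norm_nonneg (U n p - u p)]
  have hQu : Q u := hlim U u hQ hunif
  refine ⟨u, hQu, fun p hp => ?_⟩
  have h1 : Tendsto (fun n => U (n + 1) p) atTop (𝓝 (T u p)) := by
    rw [tendsto_iff_norm_sub_tendsto_zero]
    refine squeeze_zero (fun _ => norm_nonneg _) (fun n => ?_)
      (by simpa using hzero.const_mul κ)
    have h2 := hlip _ _ _ (hQ n) hQu (htail n) p hp
    have h3 := hW p hp
    rw [hUs]
    nlinarith [norm_nonneg (T (U n) p - T u p)]
  exact tendsto_nhds_unique h1 ((tendsto_add_atTop_iff_nat 1).2 (hu p hp))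

/-- An invertible dynamical system `σ` lying over the quadratic map through `a`, with a
weight `w` for which `q` expands by the factor `ν` at each step. -/
structure ExpandingModel (X : Type*) [TopologicalSpace X] (c : ℂ) where
  /-- The dynamics. -/
  σ : X ≃ₜ X
  /-- The coordinate. -/
  a : X → ℂ
  /-- The adapted weight. -/
  w : X → ℝ
  /-- The expansion factor. -/
  ν : ℝ
  /-- An upper bound for the weight. -/
  M : ℝ
  /-- A lower bound for the derivative of `q`. -/
  m : ℝ
  /-- An upper bound for the coordinate. -/
  R : ℝ
  continuous_a : Continuous a
  one_lt_ν : 1 < ν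
  one_le_M : 1 ≤ M
  m_pos : 0 < m
  R_nonneg : 0 ≤ R
  one_le_w : ∀ x, 1 ≤ w x
  w_le : ∀ x, w x ≤ M
  le_norm : ∀ x, m ≤ ‖2 * a x‖
  norm_le : ∀ x, ‖a x‖ ≤ R
  expand : ∀ x, ν * w x ≤ w (σ x) * ‖2 * a x‖
  orbit : ∀ x, a (σ x) = a x ^ 2 + c
  separates : ∀ x y, (∀ n : ℕ, a (σ^[n] x) = a (σ^[n] y)) →
    (∀ n : ℕ, a (σ.symm^[n] x) = a (σ.symm^[n] y)) → x = y

theorem eventually_mul_le_nhdsGT_zero (k : ℝ) {r : ℝ} (hr : 0 < r) :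
    ∀ᶠ ε : ℝ in 𝓝[>] 0, ε * k ≤ r := by
  have : Tendsto (fun ε : ℝ => ε * k) (𝓝[>] 0) (𝓝 0) := by
    have : Tendsto (fun ε : ℝ => ε * k) (𝓝 0) (𝓝 (0 * k)) :=
      (continuous_id.mul continuous_const).tendsto 0
    simpa using this.mono_left nhdsWithin_le_nhds
  exact (this.eventually_lt_const hr).mono fun _ h => h.le

namespace ExpandingModel

variable {X : Type*} [TopologicalSpace X] {c : ℂ} (D : ExpandingModel X c)

theorem w_pos (x : X) : 0 < D.w x := one_pos.trans_le (D.one_le_w x)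

/-- One step of the adapted expansion, applied to a solution of the linearized equation. -/
theorem weight_mul_norm_div_le (x : X) (p r : ℂ) :
    D.w x * ‖(p + r) / (2 * D.a x)‖ ≤ D.ν⁻¹ * (D.w (D.σ x) * ‖p‖) + D.w x * ‖r‖ / D.m := by
  have h1 := D.le_norm x
  have h2 := D.m_pos
  have h3 := D.one_lt_ν
  have h4 := D.expand x
  have h5 := D.w_pos x
  have h0 : 0 < ‖2 * D.a x‖ := h2.trans_le h1
  calc D.w x * ‖(p + r) / (2 * D.a x)‖ ≤ D.w x * ((‖p‖ + ‖r‖) / ‖2 * D.a x‖) := by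
        rw [norm_div]; gcongr; exact norm_add_le _ _
    _ = D.w x * ‖p‖ / ‖2 * D.a x‖ + D.w x * ‖r‖ / ‖2 * D.a x‖ := by ring
    _ ≤ _ := by
        gcongr ?_ + ?_
        · rw [div_le_iff₀ h0, inv_mul_eq_div, div_mul_eq_mul_div, le_div_iff₀ (by linarith)]
          nlinarith [norm_nonneg p]
        · gcongr

/-- The solution of the shadowing equation as a function of the parameter and the point. -/
theorem exists_shadowing : ∃ L > 0, ∀ᶠ ε : ℝ in 𝓝[>] 0, ∃ u : ℂ × X → ℂ,
    ContinuousOn u (ball 0 ε ×ˢ univ) ∧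
    (∀ x, DifferentiableOn ℂ (fun b => u (b, x)) (ball 0 ε)) ∧
    (∀ b ∈ ball (0 : ℂ) ε, ∀ x, ‖u (b, x)‖ ≤ L * ‖b‖) ∧
    ∀ b ∈ ball (0 : ℂ) ε, ∀ x, D.a (D.σ x) + u (b, D.σ x) =
      (D.a x + u (b, x)) ^ 2 + c - b * (D.a (D.σ.symm x) + u (b, D.σ.symm x)) := by
  have hm := D.m_pos
  have hν := D.one_lt_ν
  have hM := D.one_le_M
  have hR := D.R_nonneg
  set θ := D.ν⁻¹ with hθ
  have hθ0 : 0 < θ := by positivity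
  have hθ1 : θ < 1 := inv_lt_one_of_one_lt₀ hν
  set L := (D.M * D.R / D.m + 1) / (1 - θ) with hLdef
  have h1θ : 0 < 1 - θ := by linarith
  have hL : 0 < L := by positivity
  have hLeq : L * (1 - θ) = D.M * D.R / D.m + 1 := by rw [hLdef]; field_simp
  refine ⟨L, hL, ?_⟩
  filter_upwards [self_mem_nhdsWithin,
    eventually_mul_le_nhdsGT_zero ((L ^ 2 + D.M * L) / D.m) one_pos,
    eventually_mul_le_nhdsGT_zero ((2 * L + D.M) / D.m) (half_pos h1θ)] with ε hε hε1 hε2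
  replace hε : 0 < ε := hε
  refine (exists_fixedPoint_of_weighted_contraction
    (ball (0 : ℂ) ε ×ˢ (univ : Set X)) (fun p => D.w p.2) (fun p _ => D.one_le_w p.2)
    (fun u => ContinuousOn u (ball 0 ε ×ˢ univ) ∧
      (∀ x, DifferentiableOn ℂ (fun b => u (b, x)) (ball 0 ε)) ∧
      ∀ p ∈ ball (0 : ℂ) ε ×ˢ (univ : Set X), D.w p.2 * ‖u p‖ ≤ L * ‖p.1‖)
    (fun u p => (u (p.1, D.σ p.2) + (-(u p) ^ 2 +
      p.1 * (D.a (D.σ.symm p.2) + u (p.1, D.σ.symm p.2)))) / (2 * D.a p.2))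
    (κ := (1 + θ) / 2) (by positivity) (by linarith)
    ⟨fun _ => 0, continuousOn_const, fun x => differentiableOn_const _, fun p hp => by
      simp only [norm_zero, mul_zero]; positivity⟩ ?_ ?_ ?_ ?_).elim ?_
  rotate_right
  · rintro u ⟨⟨hc, hd, hb⟩, hfix⟩
    refine ⟨u, hc, hd, fun b hbε x => ?_, fun b hbε x => ?_⟩
    · have := hb (b, x) ⟨hbε, mem_univ _⟩
      nlinarith [norm_nonneg (u (b, x)), D.one_le_w x]
    · have h := hfix (b, x) ⟨hbε, mem_univ _⟩
      have h0 : 2 * D.a x ≠ 0 := norm_pos_iff.1 (hm.trans_le (D.le_norm x))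
      simp only at h
      rw [div_eq_iff h0] at h
      rw [D.orbit]
      linear_combination h
  · rintro u ⟨hc, hd, hb⟩
    have ne : ∀ x, 2 * D.a x ≠ 0 := fun x => norm_pos_iff.1 (hm.trans_le (D.le_norm x))
    refine ⟨?_, fun x => ?_, ?_⟩
    · have hσ : ∀ τ : X → X, Continuous τ →
          ContinuousOn (fun p : ℂ × X => u (p.1, τ p.2)) (ball 0 ε ×ˢ univ) := fun τ hτ =>
        hc.comp (by fun_prop) fun p hp => ⟨hp.1, mem_univ _⟩
      have ha : Continuous fun p : ℂ × X => D.a p.2 := D.continuous_a.comp continuous_snd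
      have ha' : Continuous fun p : ℂ × X => D.a (D.σ.symm p.2) :=
        D.continuous_a.comp (D.σ.symm.continuous.comp continuous_snd)
      refine ContinuousOn.div ?_ (continuous_const.mul ha).continuousOn fun p _ => ne p.2
      exact (hσ _ D.σ.continuous).add ((hc.pow 2).neg.add
        (continuous_fst.continuousOn.mul (ha'.continuousOn.add (hσ _ D.σ.symm.continuous))))
    · have h₁ := hd x
      have h₂ := hd (D.σ x)
      have h₃ := hd (D.σ.symm x)
      change DifferentiableOn ℂ (fun b => (u (b, D.σ x) + (-(u (b, x)) ^ 2 +
        b * (D.a (D.σ.symm x) + u (b, D.σ.symm x)))) / (2 * D.a x)) (ball 0 ε)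
      exact (h₂.fun_add ((h₁.fun_pow 2).fun_neg.fun_add (differentiableOn_id.fun_mul
        ((differentiableOn_const _).fun_add h₃)))).div_const _
    · rintro ⟨b, x⟩ hp
      have hbε : ‖b‖ ≤ ε := by simpa using (mem_ball_zero_iff.1 hp.1).le
      have e1 := hb (b, D.σ x) ⟨hp.1, mem_univ _⟩
      have e2 := hb (b, x) hp
      have e3 := hb (b, D.σ.symm x) ⟨hp.1, mem_univ _⟩
      simp only at e1 e2 e3 ⊢
      refine (D.weight_mul_norm_div_le _ _ _).trans ?_
      have w1 := D.one_le_w x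
      have w2 := D.w_le x
      have w3 := D.one_le_w (D.σ.symm x)
      have f2 : ‖u (b, x)‖ ≤ L * ‖b‖ := by nlinarith [norm_nonneg (u (b, x))]
      have f3 : ‖u (b, D.σ.symm x)‖ ≤ L * ‖b‖ := by nlinarith [norm_nonneg (u (b, D.σ.symm x))]
      have g : ‖-(u (b, x)) ^ 2 + b * (D.a (D.σ.symm x) + u (b, D.σ.symm x))‖ ≤
          ‖u (b, x)‖ * ‖u (b, x)‖ + ‖b‖ * (D.R + L * ‖b‖) := by
        refine (norm_add_le _ _).trans ?_
        rw [norm_neg, norm_pow, norm_mul, sq]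
        gcongr
        exact (norm_add_le _ _).trans (add_le_add (D.norm_le _) f3)
      have g' : D.w x * ‖-(u (b, x)) ^ 2 + b * (D.a (D.σ.symm x) + u (b, D.σ.symm x))‖ ≤
          ‖b‖ * (D.M * D.R + ε * (L ^ 2 + D.M * L)) := by
        calc _ ≤ D.w x * (‖u (b, x)‖ * ‖u (b, x)‖ + ‖b‖ * (D.R + L * ‖b‖)) := by gcongr
          _ = (D.w x * ‖u (b, x)‖) * ‖u (b, x)‖ + D.w x * (‖b‖ * (D.R + L * ‖b‖)) := by ring
          _ ≤ (L * ‖b‖) * (L * ε) + D.M * (‖b‖ * (D.R + L * ε)) := by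
            gcongr
            exact f2.trans (by gcongr)
          _ = _ := by ring
      calc _ ≤ θ * (L * ‖b‖) + ‖b‖ * (D.M * D.R + ε * (L ^ 2 + D.M * L)) / D.m := by gcongr
        _ = ‖b‖ * (θ * L + D.M * D.R / D.m + ε * ((L ^ 2 + D.M * L) / D.m)) := by ring
        _ ≤ ‖b‖ * L := by gcongr; linarith
        _ = _ := mul_comm _ _
  · rintro U u hU hlim
    refine ⟨hlim.continuousOn (Frequently.of_forall fun n => (hU n).1), fun x => ?_,
      fun p hp => ?_⟩
    · refine TendstoLocallyUniformlyOn.differentiableOn (F := fun n b => U n (b, x))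
        (φ := atTop) (TendstoUniformlyOn.tendstoLocallyUniformlyOn ?_)
        (Eventually.of_forall fun n => (hU n).2.1 x) isOpen_ball
      exact (hlim.comp fun b => (b, x)).mono fun b hb => ⟨hb, mem_univ _⟩
    · exact le_of_tendsto ((hlim.tendsto_at hp).norm.const_mul _)
        (Eventually.of_forall fun n => (hU n).2.2 p hp)
  · rintro u v ⟨-, -, hu⟩ ⟨-, -, hv⟩
    refine ⟨2 * (L * ε), fun p hp => ?_⟩
    have e1 := hu p hp
    have e2 := hv p hp
    have hbε : ‖p.1‖ ≤ ε := by simpa using (mem_ball_zero_iff.1 hp.1).le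
    calc _ ≤ D.w p.2 * (‖u p‖ + ‖v p‖) := by
          have := D.w_pos p.2
          gcongr; exact norm_sub_le _ _
      _ ≤ L * ‖p.1‖ + L * ‖p.1‖ := by linarith
      _ ≤ L * ε + L * ε := by gcongr
      _ = _ := by ring
  · rintro u v d ⟨-, -, hu⟩ ⟨-, -, hv⟩ hd ⟨b, x⟩ hp
    have hbε : ‖b‖ ≤ ε := by simpa using (mem_ball_zero_iff.1 hp.1).le
    have d1 := hd (b, D.σ x) ⟨hp.1, mem_univ _⟩
    have d2 := hd (b, x) hp
    have d3 := hd (b, D.σ.symm x) ⟨hp.1, mem_univ _⟩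
    have u2 := hu (b, x) hp
    have v2 := hv (b, x) hp
    simp only at d1 d2 d3 u2 v2 ⊢
    have w0 := D.w_pos x
    have w1 := D.one_le_w x
    have w2 := D.w_le x
    have w3 := D.one_le_w (D.σ.symm x)
    have u3 : ‖u (b, x)‖ ≤ L * ‖b‖ := by nlinarith [norm_nonneg (u (b, x))]
    have v3 : ‖v (b, x)‖ ≤ L * ‖b‖ := by nlinarith [norm_nonneg (v (b, x))]
    have hd0 : 0 ≤ d := le_trans (by positivity) d2
    have d4 : ‖u (b, D.σ.symm x) - v (b, D.σ.symm x)‖ ≤ d := by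
      nlinarith [norm_nonneg (u (b, D.σ.symm x) - v (b, D.σ.symm x))]
    rw [← sub_div]
    rw [show ∀ p₁ p₂ r₁ r₂ : ℂ, p₁ + r₁ - (p₂ + r₂) = (p₁ - p₂) + (r₁ - r₂) by intros; ring]
    refine (D.weight_mul_norm_div_le _ _ _).trans ?_
    have g : ‖-(u (b, x)) ^ 2 + b * (D.a (D.σ.symm x) + u (b, D.σ.symm x)) -
        (-(v (b, x)) ^ 2 + b * (D.a (D.σ.symm x) + v (b, D.σ.symm x)))‖ ≤
        ‖u (b, x) - v (b, x)‖ * (L * ε + L * ε) + ε * d := by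
      rw [show -(u (b, x)) ^ 2 + b * (D.a (D.σ.symm x) + u (b, D.σ.symm x)) -
        (-(v (b, x)) ^ 2 + b * (D.a (D.σ.symm x) + v (b, D.σ.symm x))) =
        -((u (b, x) - v (b, x)) * (u (b, x) + v (b, x))) +
          b * (u (b, D.σ.symm x) - v (b, D.σ.symm x)) by ring]
      refine (norm_add_le _ _).trans ?_
      rw [norm_neg, norm_mul, norm_mul]
      gcongr
      refine (norm_add_le _ _).trans (add_le_add (u3.trans ?_) (v3.trans ?_)) <;> gcongr
    calc _ ≤ θ * d + D.w x * (‖u (b, x) - v (b, x)‖ * (L * ε + L * ε) + ε * d) / D.m := by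
          gcongr
      _ = θ * d + ((D.w x * ‖u (b, x) - v (b, x)‖) * (2 * L * ε) + D.w x * (ε * d)) / D.m := by
          ring
      _ ≤ θ * d + (d * (2 * L * ε) + D.M * (ε * d)) / D.m := by gcongr
      _ = (θ + ε * ((2 * L + D.M) / D.m)) * d := by ring
      _ ≤ (1 + θ) / 2 * d := by gcongr; linarith
end ExpandingModel

theorem fderiv_iterate_of_eigenfield {E X : Type*} [NormedAddCommGroup E] [NormedSpace ℂ E]
    {f : E → E} (hf : Differentiable ℂ f) {Φ : X → E} {τ : X → X}
    (hconj : ∀ x, f (Φ x) = Φ (τ x)) {V : X → E} {k : X → ℂ}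
    (hV : ∀ x, fderiv ℂ f (Φ x) (V x) = k x • V (τ x)) {w : X → ℝ} {θ : ℝ} (hθ : 0 ≤ θ)
    (hk : ∀ x, ‖k x‖ * w (τ x) ≤ θ * w x) (n : ℕ) (x : X) :
    ∃ K : ℂ, fderiv ℂ (f^[n]) (Φ x) (V x) = K • V (τ^[n] x) ∧
      ‖K‖ * w (τ^[n] x) ≤ θ ^ n * w x := by
  induction n generalizing x with
  | zero => exact ⟨1, by simp, by simp⟩
  | succ n ih =>
    obtain ⟨K, h1, h2⟩ := ih (τ x)
    refine ⟨k x * K, ?_, ?_⟩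
    · rw [Function.iterate_succ, fderiv_comp _ (hf.iterate n _) (hf _), hconj,
        ContinuousLinearMap.comp_apply, hV, map_smul, h1, smul_smul, Function.iterate_succ_apply]
    · rw [Function.iterate_succ_apply, norm_mul, mul_assoc]
      calc ‖k x‖ * (‖K‖ * w (τ^[n] (τ x))) ≤ ‖k x‖ * (θ ^ n * w (τ x)) := by gcongr
        _ = θ ^ n * (‖k x‖ * w (τ x)) := by ring
        _ ≤ θ ^ n * (θ * w x) := by exact mul_le_mul_of_nonneg_left (hk x) (by positivity)
        _ = _ := by ring

theorem norm_fderiv_iterate_le_of_eigenfield {E X : Type*} [NormedAddCommGroup E]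
    [NormedSpace ℂ E] {f : E → E} (hf : Differentiable ℂ f) {Φ : X → E} {τ : X → X}
    (hconj : ∀ x, f (Φ x) = Φ (τ x)) {V : X → E} {k : X → ℂ}
    (hV : ∀ x, fderiv ℂ f (Φ x) (V x) = k x • V (τ x)) {w : X → ℝ} {θ : ℝ} (hθ : 0 ≤ θ)
    (hk : ∀ x, ‖k x‖ * w (τ x) ≤ θ * w x) {M B : ℝ} (hw : ∀ x, 1 ≤ w x) (hwM : ∀ x, w x ≤ M)
    (hV1 : ∀ x, 1 ≤ ‖V x‖) (hVB : ∀ x, ‖V x‖ ≤ B) (n : ℕ) (x : X) {v : E}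
    (hv : v ∈ Submodule.span ℂ {V x}) :
    ‖fderiv ℂ (f^[n]) (Φ x) v‖ ≤ M * B * θ ^ n * ‖v‖ := by
  obtain ⟨t, rfl⟩ := Submodule.mem_span_singleton.1 hv
  obtain ⟨K, h1, h2⟩ := fderiv_iterate_of_eigenfield hf hconj hV hθ hk n x
  have hK : ‖K‖ ≤ θ ^ n * M := by
    calc ‖K‖ ≤ ‖K‖ * w (τ^[n] x) := le_mul_of_one_le_right (norm_nonneg _) (hw _)
      _ ≤ θ ^ n * w x := h2
      _ ≤ _ := by gcongr; exact hwM x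
  have hM : 0 ≤ M := zero_le_one.trans ((hw x).trans (hwM x))
  have hB : 0 ≤ B := (norm_nonneg _).trans (hVB x)
  rw [map_smul, h1, norm_smul, norm_smul, norm_smul]
  calc ‖t‖ * (‖K‖ * ‖V (τ^[n] x)‖) ≤ ‖t‖ * ((θ ^ n * M) * B) := by gcongr; exact hVB _
    _ = M * B * θ ^ n * (‖t‖ * 1) := by ring
    _ ≤ _ := by gcongr; exact hV1 x

/-- The projection of `ℂ²` onto the line through `(s, 1)` along the line through `(e, 1)`. -/
def slopeProj (s e : ℂ) : ℂ × ℂ →L[ℂ] ℂ × ℂ :=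
  (e - s)⁻¹ • (ContinuousLinearMap.inl ℂ ℂ ℂ ∘L
      ((e * s) • ContinuousLinearMap.snd ℂ ℂ ℂ - s • ContinuousLinearMap.fst ℂ ℂ ℂ) +
    ContinuousLinearMap.inr ℂ ℂ ℂ ∘L
      (e • ContinuousLinearMap.snd ℂ ℂ ℂ - ContinuousLinearMap.fst ℂ ℂ ℂ))

theorem slopeProj_apply (s e : ℂ) (v : ℂ × ℂ) :
    slopeProj s e v = ((e - s)⁻¹ * (e * v.2 - v.1)) • ((s, 1) : ℂ × ℂ) := by
  ext <;> simp [slopeProj]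
  ring

theorem sub_slopeProj_apply {s e : ℂ} (h : e - s ≠ 0) (v : ℂ × ℂ) :
    v - slopeProj s e v = ((e - s)⁻¹ * (v.1 - s * v.2)) • ((e, 1) : ℂ × ℂ) := by
  rw [slopeProj_apply]
  ext <;> simp <;> field_simp <;> ring

theorem slopeProj_apply_left {s e : ℂ} (h : e - s ≠ 0) (t : ℂ) :
    slopeProj s e (t • (s, 1)) = t • (s, 1) := by
  rw [slopeProj_apply]
  congr 1
  simp
  field_simp

theorem slopeProj_apply_right (s e t : ℂ) : slopeProj s e (t • (e, 1)) = 0 := by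
  rw [slopeProj_apply]
  simp [mul_comm]

theorem continuousOn_slopeProj {Z : Type*} [TopologicalSpace Z] {K : Set Z} {s e : Z → ℂ}
    (hs : ContinuousOn s K) (he : ContinuousOn e K) (h : ∀ z ∈ K, e z - s z ≠ 0) :
    ContinuousOn (fun z => slopeProj (s z) (e z)) K := by
  have hA : ContinuousOn (fun z => (e z * s z) • ContinuousLinearMap.snd ℂ ℂ ℂ -
      s z • ContinuousLinearMap.fst ℂ ℂ ℂ) K :=
    ((he.mul hs).smul continuousOn_const).sub (hs.smul continuousOn_const)
  have hB : ContinuousOn (fun z => e z • ContinuousLinearMap.snd ℂ ℂ ℂ -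
      ContinuousLinearMap.fst ℂ ℂ ℂ) K := (he.smul continuousOn_const).sub continuousOn_const
  exact ((he.sub hs).inv₀ h).smul
    ((continuousOn_const.clm_comp hA).add (continuousOn_const.clm_comp hB))

theorem Topology.IsEmbedding.continuousOn_extend {X Y Z : Type*} [TopologicalSpace X]
    [TopologicalSpace Y] [TopologicalSpace Z] {Φ : X → Y} (hΦ : IsEmbedding Φ) {g : X → Z}
    (hg : Continuous g) (d : Y → Z) : ContinuousOn (Function.extend Φ g d) (range Φ) := by
  rw [continuousOn_iff_continuous_domRestrict]
  have : (range Φ).domRestrict (Function.extend Φ g d) = g ∘ hΦ.toHomeomorph.symm := by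
    funext ⟨z, x, hx⟩
    subst hx
    have : hΦ.toHomeomorph.symm ⟨Φ x, x, rfl⟩ = x := hΦ.toHomeomorph.symm_apply_apply x
    simp [domRestrict, hΦ.injective.extend_apply, this]
  rw [this]
  exact hg.comp (Homeomorph.continuous _)

/-- A set carrying two transverse continuous fields of lines that are permuted by the
derivative, one contracted and one expanded in a bounded weight, is hyperbolic. -/
theorem isHyperbolicSet_range {X : Type*} [TopologicalSpace X] (σ : X ≃ₜ X) {Φ : X → ℂ × ℂ}
    (hΦ : IsEmbedding Φ) {f finv : ℂ × ℂ → ℂ × ℂ} (hf : Differentiable ℂ f)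
    (hfinv : Differentiable ℂ finv) (hconj : ∀ x, f (Φ x) = Φ (σ x))
    (hconj' : ∀ x, finv (Φ x) = Φ (σ.symm x)) {s e : X → ℂ} (hsc : Continuous s)
    (hec : Continuous e)
    (hs : ∀ x, fderiv ℂ f (Φ x) (s x, 1) = s x • (s (σ x), 1))
    (he : ∀ x, fderiv ℂ f (Φ x) (e x, 1) = e x • (e (σ x), 1))
    (he' : ∀ x, fderiv ℂ finv (Φ x) (e x, 1) = (e (σ.symm x))⁻¹ • (e (σ.symm x), 1))
    (hs0 : ∀ x, s x ≠ 0) (he0 : ∀ x, e x ≠ 0) (hes : ∀ x, e x - s x ≠ 0)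
    (hs1 : ∀ x, ‖s x‖ ≤ 1 / 2) {w : X → ℝ} {M B μ : ℝ} (hM : 0 < M) (hw : ∀ x, 1 ≤ w x)
    (hwM : ∀ x, w x ≤ M) (hμ : 1 < μ) (hwe : ∀ x, μ * w x ≤ w (σ x) * ‖e x‖)
    (hB : 1 ≤ B) (heB : ∀ x, ‖e x‖ ≤ B) : IsHyperbolicSet f finv (range Φ) := by
  have ext_apply : ∀ (g : X → ℂ) (x : X), Function.extend Φ g 0 (Φ x) = g x := fun g x =>
    hΦ.injective.extend_apply g 0 x
  have ext_cont : ∀ g : X → ℂ, Continuous g →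
      ContinuousOn (Function.extend Φ g 0) (range Φ) := fun g hg => hΦ.continuousOn_extend hg 0
  have map_line : ∀ (g : X → ℂ), (∀ x, fderiv ℂ f (Φ x) (g x, 1) = g x • (g (σ x), 1)) →
      (∀ x, g x ≠ 0) → ∀ z ∈ range Φ,
      (Submodule.span ℂ {((Function.extend Φ g 0 z, 1) : ℂ × ℂ)}).map
        (fderiv ℂ f z).toLinearMap =
        Submodule.span ℂ {((Function.extend Φ g 0 (f z), 1) : ℂ × ℂ)} := by
    rintro g hg hg0 _ ⟨x, rfl⟩
    rw [hconj, ext_apply, ext_apply, Submodule.map_span, image_singleton]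
    have : (fderiv ℂ f (Φ x)).toLinearMap (g x, 1) = g x • ((g (σ x), 1) : ℂ × ℂ) := hg x
    rw [this]
    exact Submodule.span_singleton_smul_eq (hg0 x).isUnit _
  refine ⟨fun z => Submodule.span ℂ {((Function.extend Φ s 0 z, 1) : ℂ × ℂ)},
    fun z => Submodule.span ℂ {((Function.extend Φ e 0 z, 1) : ℂ × ℂ)},
    fun z => slopeProj (Function.extend Φ s 0 z) (Function.extend Φ e 0 z),
    1, M * B, 1 / 2, μ, one_pos, by positivity, by norm_num, by norm_num, hμ, ?_, ?_, ?_, ?_,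
    map_line s hs hs0, map_line e he he0, ?_, ?_⟩
  · refine continuousOn_slopeProj (ext_cont s hsc) (ext_cont e hec) ?_
    rintro _ ⟨x, rfl⟩
    rw [ext_apply, ext_apply]
    exact hes x
  · rintro _ ⟨x, rfl⟩ v
    beta_reduce
    rw [ext_apply, ext_apply, sub_slopeProj_apply (hes x), slopeProj_apply]
    exact ⟨Submodule.mem_span_singleton.2 ⟨_, rfl⟩, Submodule.mem_span_singleton.2 ⟨_, rfl⟩⟩
  · rintro _ ⟨x, rfl⟩ v hv
    beta_reduce at hv ⊢
    rw [ext_apply] at hv ⊢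
    rw [ext_apply]
    obtain ⟨t, rfl⟩ := Submodule.mem_span_singleton.1 hv
    exact slopeProj_apply_left (hes x) t
  · rintro _ ⟨x, rfl⟩ v hv
    beta_reduce at hv ⊢
    rw [ext_apply] at hv ⊢
    rw [ext_apply]
    obtain ⟨t, rfl⟩ := Submodule.mem_span_singleton.1 hv
    exact slopeProj_apply_right _ _ t
  · rintro _ ⟨x, rfl⟩ n - v hv
    beta_reduce at hv ⊢
    rw [ext_apply] at hv
    have hnorm : ∀ x, ‖((s x, 1) : ℂ × ℂ)‖ = 1 := fun x => by
      rw [Prod.norm_mk, norm_one, max_eq_right]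
      linarith [hs1 x]
    simpa using norm_fderiv_iterate_le_of_eigenfield hf hconj (V := fun x => (s x, 1)) hs
      (w := fun _ => 1) (θ := 1 / 2) (by norm_num) (fun x => by simpa using hs1 x) (M := 1)
      (B := 1) (fun _ => le_rfl) (fun _ => le_rfl) (fun x => (hnorm x).ge)
      (fun x => (hnorm x).le) n x hv
  · rintro _ ⟨x, rfl⟩ n - v hv
    beta_reduce at hv ⊢
    rw [ext_apply] at hv
    rw [← inv_pow]
    refine norm_fderiv_iterate_le_of_eigenfield hfinv hconj' (V := fun x => (e x, 1)) he'
      (w := w) (θ := μ⁻¹) (by positivity) (fun x => ?_) hw hwM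
      (fun x => by simp [Prod.norm_mk]) (fun x => by simp [Prod.norm_mk, heB x, hB]) n x hv
    have h1 := hwe (σ.symm x)
    rw [σ.apply_symm_apply] at h1
    have h2 : 0 < ‖e (σ.symm x)‖ := norm_pos_iff.2 (he0 _)
    rw [norm_inv, inv_mul_eq_div, inv_mul_eq_div, div_le_div_iff₀ h2 (by positivity)]
    linarith

theorem differentiable_henon (c b : ℂ) : Differentiable ℂ (henon c b) := by
  unfold henon; fun_prop

theorem differentiable_henonInv (c b : ℂ) : Differentiable ℂ (henonInv c b) := by
  have : henonInv c b = fun p => (p.2, (p.2 ^ 2 + c - p.1) * b⁻¹) := rfl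
  rw [this]; fun_prop

theorem fderiv_henon_apply (c b : ℂ) (p v : ℂ × ℂ) :
    fderiv ℂ (henon c b) p v = (2 * p.1 * v.1 - b * v.2, v.1) := by
  have h1 : HasFDerivAt (fun p : ℂ × ℂ => p.1) (ContinuousLinearMap.fst ℂ ℂ ℂ) p := hasFDerivAt_fst
  have h2 : HasFDerivAt (fun p : ℂ × ℂ => p.2) (ContinuousLinearMap.snd ℂ ℂ ℂ) p := hasFDerivAt_snd
  have h := (((h1.pow 2).add_const c).fun_sub (h2.const_mul b)).prodMk h1
  have h' : fderiv ℂ (henon c b) p = _ := h.fderiv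
  rw [h']
  simp

theorem fderiv_henonInv_apply (c b : ℂ) (p v : ℂ × ℂ) :
    fderiv ℂ (henonInv c b) p v = (v.2, (2 * p.2 * v.2 - v.1) / b) := by
  have h1 : HasFDerivAt (fun p : ℂ × ℂ => p.1) (ContinuousLinearMap.fst ℂ ℂ ℂ) p := hasFDerivAt_fst
  have h2 : HasFDerivAt (fun p : ℂ × ℂ => p.2) (ContinuousLinearMap.snd ℂ ℂ ℂ) p := hasFDerivAt_snd
  have h := h2.prodMk ((((h2.pow 2).add_const c).fun_sub h1).mul_const b⁻¹)
  have h' : fderiv ℂ (henonInv c b) p = _ := h.fderiv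
  rw [h']
  simp
  ring

theorem henonInv_henon {b : ℂ} (hb : b ≠ 0) (c : ℂ) (p : ℂ × ℂ) :
    henonInv c b (henon c b p) = p := by
  ext <;> simp [henon, henonInv, hb]

/-- A continuous solution of the slope recursion `s x = p x + b / (q x + k * s (τ x))`, when the
denominators stay away from zero and `b` is small. -/
theorem exists_slope_field {X : Type*} [TopologicalSpace X] {τ : X → X} (hτ : Continuous τ)
    {p q : X → ℂ} (hp : Continuous p) (hq : Continuous q) {b k : ℂ} {δ η : ℝ} (hδ : 0 < δ)
    (hη : 0 ≤ η) (hk : ‖k‖ ≤ 1) (hden : ∀ x y, ‖y - p (τ x)‖ ≤ η → δ ≤ ‖q x + k * y‖)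
    (hbη : ‖b‖ / δ ≤ η) (hbδ : ‖b‖ / δ ^ 2 ≤ 1 / 2) :
    ∃ s : X → ℂ, Continuous s ∧ (∀ x, ‖s x - p x‖ ≤ η) ∧
      ∀ x, s x = p x + b / (q x + k * s (τ x)) := by
  have key := exists_fixedPoint_of_weighted_contraction (univ : Set X) (fun _ => 1)
    (fun _ _ => le_rfl) (fun s => Continuous s ∧ ∀ x, ‖s x - p x‖ ≤ η)
    (fun s x => p x + b / (q x + k * s (τ x))) (κ := 1 / 2) (by norm_num) (by norm_num)
    ⟨p, hp, fun x => by simpa using hη⟩ ?_ ?_ ?_ ?_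
  · obtain ⟨s, ⟨h1, h2⟩, h3⟩ := key
    exact ⟨s, h1, h2, fun x => (h3 x (mem_univ x)).symm⟩
  · rintro s ⟨h1, h2⟩
    have hd : ∀ x, δ ≤ ‖q x + k * s (τ x)‖ := fun x => hden x _ (h2 (τ x))
    have hd0 : ∀ x, q x + k * s (τ x) ≠ 0 := fun x => norm_pos_iff.1 (hδ.trans_le (hd x))
    refine ⟨hp.add (continuous_const.div
      (hq.add (continuous_const.mul (h1.comp hτ))) hd0), fun x => ?_⟩
    rw [add_sub_cancel_left, norm_div]
    exact (div_le_div_of_nonneg_left (norm_nonneg _) hδ (hd x)).trans hbη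
  · rintro U u hU hlim
    rw [tendstoUniformlyOn_univ] at hlim
    refine ⟨hlim.continuous (Frequently.of_forall fun n => (hU n).1), fun x => ?_⟩
    exact le_of_tendsto ((hlim.tendsto_at x).sub_const _).norm
      (Eventually.of_forall fun n => (hU n).2 x)
  · rintro u v ⟨-, hu⟩ ⟨-, hv⟩
    refine ⟨η + η, fun x _ => ?_⟩
    rw [one_mul, show u x - v x = (u x - p x) - (v x - p x) by ring]
    exact (norm_sub_le _ _).trans (add_le_add (hu x) (hv x))
  · rintro u v d ⟨-, hu⟩ ⟨-, hv⟩ hd x -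
    have hud := hden x _ (hu (τ x))
    have hvd := hden x _ (hv (τ x))
    have hu0 : q x + k * u (τ x) ≠ 0 := norm_pos_iff.1 (hδ.trans_le hud)
    have hv0 : q x + k * v (τ x) ≠ 0 := norm_pos_iff.1 (hδ.trans_le hvd)
    have hd' : ‖v (τ x) - u (τ x)‖ ≤ d := by
      rw [norm_sub_rev]; simpa using hd (τ x) (mem_univ _)
    have hd0 : 0 ≤ d := (norm_nonneg _).trans hd'
    rw [one_mul, show p x + b / (q x + k * u (τ x)) - (p x + b / (q x + k * v (τ x))) =
      b * (k * (v (τ x) - u (τ x))) / ((q x + k * u (τ x)) * (q x + k * v (τ x))) by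
        field_simp; ring, norm_div, norm_mul, norm_mul, norm_mul]
    calc _ ≤ ‖b‖ * (1 * d) / (δ * δ) := by gcongr
      _ = ‖b‖ / δ ^ 2 * d := by rw [sq]; ring
      _ ≤ _ := by gcongr

namespace ExpandingModel

variable {X : Type*} [TopologicalSpace X] {c : ℂ} (D : ExpandingModel X c)

theorem injective_of_shadowing {Y : X → ℂ} {b : ℂ} {ρ : ℝ} (hb : b ≠ 0)
    (hρ : 2 * ρ / D.m ≤ (1 - D.ν⁻¹) / 2) (hY : ∀ x, ‖Y x - D.a x‖ ≤ ρ)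
    (heq : ∀ x, Y (D.σ x) = Y x ^ 2 + c - b * Y (D.σ.symm x)) :
    Function.Injective fun x => (Y (D.σ x), Y x) := by
  have hm := D.m_pos
  have hν := D.one_lt_ν
  have hM := D.one_le_M
  set θ := D.ν⁻¹ with hθ
  have hθ0 : 0 < θ := by positivity
  have hθ1 : θ < 1 := inv_lt_one_of_one_lt₀ hν
  let R : X → X → Prop := fun x y => Y (D.σ x) = Y (D.σ y) ∧ Y x = Y y
  have fwd : ∀ x y, R x y → R (D.σ x) (D.σ y) := by
    rintro x y ⟨h1, h2⟩
    refine ⟨?_, h1⟩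
    rw [heq, heq (D.σ y), h1, D.σ.symm_apply_apply, D.σ.symm_apply_apply, h2]
  have bwd : ∀ x y, R x y → R (D.σ.symm x) (D.σ.symm y) := by
    rintro x y ⟨h1, h2⟩
    refine ⟨by simpa using h2, ?_⟩
    rw [heq, heq y, h2] at h1
    exact mul_left_cancel₀ hb (sub_right_injective h1)
  have close : ∀ x y, R x y → ‖D.a y - D.a x‖ ≤ 2 * ρ := by
    rintro x y ⟨-, h⟩
    calc ‖D.a y - D.a x‖ = ‖(Y x - D.a x) - (Y y - D.a y)‖ := by rw [h]; congr 1; ring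
      _ ≤ _ := norm_sub_le _ _
      _ ≤ 2 * ρ := by linarith [hY x, hY y]
  set κ := 2 * θ / (1 + θ) with hκ
  have hκ1 : κ < 1 := by rw [hκ, div_lt_one (by positivity)]; linarith
  have step : ∀ x y, R x y → D.w x * ‖D.a y - D.a x‖ ≤
      κ * (D.w (D.σ x) * ‖D.a (D.σ y) - D.a (D.σ x)‖) := by
    intro x y hR
    have h0 : 2 * D.a x ≠ 0 := norm_pos_iff.1 (hm.trans_le (D.le_norm x))
    have h1 : D.a y - D.a x =
        ((D.a (D.σ y) - D.a (D.σ x)) + -(D.a y - D.a x) ^ 2) / (2 * D.a x) := by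
      rw [D.orbit, D.orbit, eq_div_iff h0]; ring
    have h2 := D.weight_mul_norm_div_le x (D.a (D.σ y) - D.a (D.σ x)) (-(D.a y - D.a x) ^ 2)
    rw [← h1, norm_neg, norm_pow] at h2
    have hw := D.w_pos x
    have h3 : D.w x * ‖D.a y - D.a x‖ ^ 2 / D.m ≤
        D.w x * ‖D.a y - D.a x‖ * ((1 - θ) / 2) := by
      calc _ = D.w x * ‖D.a y - D.a x‖ * (‖D.a y - D.a x‖ / D.m) := by ring
        _ ≤ D.w x * ‖D.a y - D.a x‖ * (2 * ρ / D.m) := by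
          gcongr; exact close x y hR
        _ ≤ _ := by gcongr
    rw [hκ, div_mul_eq_mul_div, le_div_iff₀ (by positivity)]
    linarith
  have iter : ∀ n : ℕ, ∀ x y, R x y → D.w x * ‖D.a y - D.a x‖ ≤ κ ^ n * (D.M * (2 * ρ)) := by
    intro n
    induction n with
    | zero =>
      intro x y hR
      rw [pow_zero, one_mul]
      exact mul_le_mul (D.w_le x) (close x y hR) (norm_nonneg _) (by linarith)
    | succ n ih =>
      intro x y hR
      calc _ ≤ κ * (D.w (D.σ x) * ‖D.a (D.σ y) - D.a (D.σ x)‖) := step x y hR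
        _ ≤ κ * (κ ^ n * (D.M * (2 * ρ))) := by exact mul_le_mul_of_nonneg_left (ih _ _ (fwd _ _ hR)) (by positivity)
        _ = _ := by ring
  have key : ∀ x y, R x y → D.a x = D.a y := by
    intro x y hR
    have hlim : Tendsto (fun n : ℕ => κ ^ n * (D.M * (2 * ρ))) atTop (𝓝 0) := by
      simpa using (tendsto_pow_atTop_nhds_zero_of_lt_one (by positivity) hκ1).mul_const
        (D.M * (2 * ρ))
    have h1 : D.w x * ‖D.a y - D.a x‖ ≤ 0 := ge_of_tendsto' hlim fun n => iter n x y hR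
    have h2 : ‖D.a y - D.a x‖ ≤ 0 := by
      by_contra! h
      exact absurd h1 (not_le.2 (mul_pos (D.w_pos x) h))
    exact (sub_eq_zero.1 (norm_le_zero_iff.1 h2)).symm
  intro x y hxy
  have hR : R x y := Prod.ext_iff.1 hxy
  refine D.separates x y (fun n => key _ _ ?_) (fun n => key _ _ ?_)
  · induction n with
    | zero => exact hR
    | succ n ih => rw [Function.iterate_succ_apply', Function.iterate_succ_apply']; exact fwd _ _ ih
  · induction n with
    | zero => exact hR
    | succ n ih => rw [Function.iterate_succ_apply', Function.iterate_succ_apply']; exact bwd _ _ ih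

theorem isHyperbolicSet_of_shadowing {Y : X → ℂ} (hYc : Continuous Y) {b : ℂ} {ρ η : ℝ}
    (hb : b ≠ 0) (hY : ∀ x, ‖Y x - D.a x‖ ≤ ρ)
    (heq : ∀ x, Y (D.σ x) = Y x ^ 2 + c - b * Y (D.σ.symm x))
    (hΦ : IsEmbedding fun x => (Y (D.σ x), Y x)) (hη : 0 ≤ η)
    (hη1 : η ≤ 1 / 2) (hηm : η ≤ D.m / 8) (hηM : D.M * (η + 2 * ρ) ≤ (D.ν - 1) / 2)
    (hρm : 2 * ρ ≤ D.m / 2) (hbη : ‖b‖ / (D.m / 4) ≤ η) (hbm : ‖b‖ / (D.m / 4) ^ 2 ≤ 1 / 2) :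
    IsHyperbolicSet (henon c b) (henonInv c b) (range fun x => (Y (D.σ x), Y x)) := by
  have hm := D.m_pos
  have hM := D.one_le_M
  have hν := D.one_lt_ν
  have hρ : ∀ x, ‖2 * Y x - 2 * D.a x‖ ≤ 2 * ρ := fun x => by
    rw [← mul_sub, norm_mul, Complex.norm_ofNat]
    linarith [hY x]
  have hYm : ∀ x, D.m / 2 ≤ ‖2 * Y x‖ := fun x => by
    have h1 := D.le_norm x
    have h2 := hρ x
    have h3 := norm_sub_norm_le (2 * D.a x) (2 * Y x)
    rw [norm_sub_rev] at h3
    linarith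
  obtain ⟨s, hsc, hsη, hs⟩ := exists_slope_field (τ := D.σ) D.σ.continuous
    (p := fun _ => 0) (q := fun x => 2 * Y (D.σ x)) continuous_const
    (continuous_const.mul (hYc.comp D.σ.continuous)) (b := b) (k := -1) (δ := D.m / 4) (η := η)
    (by positivity) hη (by simp) (fun x y hy => by
      have h1 := hYm (D.σ x)
      have h2 := norm_sub_norm_le (2 * Y (D.σ x)) y
      rw [sub_zero] at hy
      rw [neg_one_mul, ← sub_eq_add_neg]
      linarith) hbη hbm
  obtain ⟨e, hec, heη, he⟩ := exists_slope_field (τ := D.σ.symm) D.σ.symm.continuous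
    (p := fun x => 2 * Y x) (q := fun x => 0) (continuous_const.mul hYc)
    continuous_const (b := -b) (k := 1) (δ := D.m / 4) (η := η)
    (by positivity) hη (by simp) (fun x y hy => by
      have h1 := hYm (D.σ.symm x)
      have h2 := norm_sub_norm_le (2 * Y (D.σ.symm x)) y
      rw [norm_sub_rev] at hy
      rw [one_mul, zero_add]
      linarith) (by rwa [norm_neg]) (by rwa [norm_neg])
  simp only [zero_add, sub_zero, neg_one_mul, one_mul, ← sub_eq_add_neg] at hs hsη he
  have hse : ∀ x, ‖s x‖ ≤ D.m / 8 := fun x => (hsη x).trans hηm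
  have hem : ∀ x, D.m / 4 ≤ ‖e x‖ := fun x => by
    have h1 := hYm x
    have h2 := norm_sub_norm_le (2 * Y x) (e x)
    have h3 := heη x
    rw [norm_sub_rev] at h3
    linarith
  have hden : ∀ x, 2 * Y (D.σ x) - s (D.σ x) ≠ 0 := fun x h => by
    have h1 := hYm (D.σ x)
    have h2 := hse (D.σ x)
    rw [sub_eq_zero.1 h] at h1
    linarith
  have he0 : ∀ x, e x ≠ 0 := fun x => norm_pos_iff.1 (by linarith [hem x])
  have hs0 : ∀ x, s x ≠ 0 := fun x => by
    rw [hs x]; exact div_ne_zero hb (hden x)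
  refine isHyperbolicSet_range D.σ hΦ (differentiable_henon c b) (differentiable_henonInv c b)
    ?_ ?_ hsc hec ?_ ?_ ?_ hs0 he0 ?_ (fun x => (hsη x).trans hη1) (w := D.w) (M := D.M)
    (B := 1 + (2 * D.R + D.m / 2 + η)) (μ := (1 + D.ν) / 2) (by linarith) D.one_le_w D.w_le
    (by linarith) ?_ ?_ ?_
  · intro x
    ext
    · simp [henon, heq (D.σ x)]
    · simp [henon]
  · intro x
    ext
    · simp [henonInv]
    · simp only [henonInv]
      rw [div_eq_iff hb, heq x]
      ring
  · intro x
    rw [fderiv_henon_apply]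
    have h := hs x
    rw [eq_div_iff (hden x)] at h
    ext
    · simp only [Prod.smul_mk, smul_eq_mul]
      linear_combination h
    · simp
  · intro x
    rw [fderiv_henon_apply]
    have h := he (D.σ x)
    rw [D.σ.symm_apply_apply] at h
    have h0 := he0 x
    ext
    · simp only [Prod.smul_mk, smul_eq_mul]
      rw [h]
      field_simp
      ring
    · simp
  · intro x
    rw [fderiv_henonInv_apply]
    have h := he x
    have h0 := he0 (D.σ.symm x)
    ext
    · simp [h0]
    · simp only [Prod.smul_mk, smul_eq_mul]
      rw [h]
      field_simp
      ring
  · intro x h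
    have h1 := hem x
    rw [sub_eq_zero.1 h] at h1
    linarith [hse x]
  · intro x
    have h1 : ‖2 * D.a x‖ - ‖e x‖ ≤ η + 2 * ρ := by
      refine (norm_sub_norm_le _ _).trans ?_
      rw [norm_sub_rev, show e x - 2 * D.a x = (e x - 2 * Y x) + (2 * Y x - 2 * D.a x) by ring]
      exact (norm_add_le _ _).trans (add_le_add (heη x) (hρ x))
    have h2 := D.expand x
    have h3 : 0 ≤ η + 2 * ρ := add_nonneg hη ((norm_nonneg _).trans (hρ x))
    have h4 : D.w (D.σ x) * (‖2 * D.a x‖ - ‖e x‖) ≤ (D.ν - 1) / 2 := by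
      refine le_trans ?_ hηM
      have := D.w_pos (D.σ x)
      have := D.w_le (D.σ x)
      exact (mul_le_mul_of_nonneg_left h1 (by positivity)).trans
        (mul_le_mul_of_nonneg_right this h3)
    have h5 := D.one_le_w x
    nlinarith
  · linarith [D.R_nonneg]
  · intro x
    have h1 : ‖e x‖ ≤ ‖e x - 2 * Y x‖ + ‖2 * Y x - 2 * D.a x‖ + ‖2 * D.a x‖ := by
      refine le_trans (le_of_eq ?_) (norm_add₃_le)
      congr 1; ring
    have h2 : ‖2 * D.a x‖ ≤ 2 * D.R := by
      rw [norm_mul, Complex.norm_ofNat]; linarith [D.norm_le x]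
    linarith [heη x, hρ x]

end ExpandingModel

theorem hasDerivAt_qmap (c z : ℂ) : HasDerivAt (qmap c) (2 * z) z := by
  change HasDerivAt (fun x => x ^ 2 + c) (2 * z) z
  simpa using hasDerivAt_pow 2 z

/-- A weight `w`, bounded above and at least `1`, in which an expanding quadratic map expands
at each step. -/
theorem exists_adapted_weight {c : ℂ} {Λ : Set ℂ} (hcomp : IsCompact Λ)
    (hexp : IsExpandingOn (qmap c) Λ) :
    ∃ (w : ℂ → ℝ) (ν M : ℝ), 1 < ν ∧ 1 ≤ M ∧ (∀ z, 1 ≤ w z) ∧ (∀ z ∈ Λ, w z ≤ M) ∧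
      ∀ z ∈ Λ, ν * w z ≤ w (qmap c z) * ‖2 * z‖ := by
  obtain ⟨C, hC, lam, hlam, hexp⟩ := hexp
  have hqd : Differentiable ℂ (qmap c) := by unfold qmap; fun_prop
  have hsucc : ∀ n z, deriv ((qmap c)^[n + 1]) z = deriv ((qmap c)^[n]) (qmap c z) * (2 * z) := by
    intro n z
    rw [Function.iterate_succ, deriv_comp _ (hqd.iterate n _) (hqd _), (hasDerivAt_qmap c z).deriv]
  have hcont : ∀ n, Continuous (deriv ((qmap c)^[n])) := fun n =>
    ((hqd.iterate n).contDiff (n := 1)).continuous_deriv le_rfl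
  obtain ⟨ν, hν1, hν⟩ := exists_between hlam
  have hν0 : 0 < ν := by linarith
  obtain ⟨N, hN1, hN⟩ : ∃ N : ℕ, 1 ≤ N ∧ ν ^ N ≤ C * lam ^ N := by
    have h1 : Tendsto (fun n : ℕ => (lam / ν) ^ n) atTop atTop :=
      tendsto_pow_atTop_atTop_of_one_lt ((one_lt_div hν0).2 hν)
    obtain ⟨N, h2, h3⟩ := ((eventually_ge_atTop 1).and (h1.eventually_ge_atTop C⁻¹)).exists
    refine ⟨N, h2, ?_⟩
    rw [div_pow, le_div_iff₀ (by positivity), inv_mul_le_iff₀ hC] at h3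
    exact h3
  set w : ℂ → ℝ := fun z => ∑ n ∈ Finset.range N, ‖deriv ((qmap c)^[n]) z‖ * (ν ^ n)⁻¹ with hw
  have hwc : Continuous w := continuous_finsetSum _ fun n _ => (hcont n).norm.mul continuous_const
  obtain ⟨M, hM⟩ := hcomp.exists_bound_of_continuousOn hwc.continuousOn
  refine ⟨w, ν, max M 1, hν1, le_max_right _ _, fun z => ?_,
    fun z hz => (le_abs_self _).trans ((hM z hz).trans (le_max_left _ _)), fun z hz => ?_⟩
  · have h := Finset.single_le_sum (f := fun n => ‖deriv ((qmap c)^[n]) z‖ * (ν ^ n)⁻¹)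
      (fun n _ => by positivity) (Finset.mem_range.2 hN1)
    simpa using h
  · have h1 : w (qmap c z) * ‖2 * z‖ =
        ∑ n ∈ Finset.range N, ν * (‖deriv ((qmap c)^[n + 1]) z‖ * (ν ^ (n + 1))⁻¹) := by
      rw [hw, Finset.sum_mul]
      refine Finset.sum_congr rfl fun n _ => ?_
      rw [hsucc, norm_mul _ (2 * z), pow_succ]
      generalize ‖2 * z‖ = r
      field_simp
    rw [h1, ← Finset.mul_sum]
    gcongr
    have h2 := Finset.sum_range_succ' (fun n => ‖deriv ((qmap c)^[n]) z‖ * (ν ^ n)⁻¹) N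
    rw [Finset.sum_range_succ] at h2
    have h3 : 1 ≤ ‖deriv ((qmap c)^[N]) z‖ * (ν ^ N)⁻¹ := by
      rw [← div_eq_mul_inv, one_le_div (by positivity)]
      exact hN.trans (hexp z hz N hN1)
    simp only [Function.iterate_zero, deriv_id, norm_one, pow_zero, inv_one, mul_one] at h2
    linarith

/-- The shift on bi-infinite orbits, as a homeomorphism. -/
def sigmaShiftHomeomorph {X : Type*} [TopologicalSpace X] (f : X → X) (S : Set X) :
    SigmaSet f S ≃ₜ SigmaSet f S where
  toFun := sigmaShift f S
  invFun z := ⟨fun i => z.1 (i - 1), fun i => z.2.1 (i - 1), fun i =>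
    (z.2.2 _).trans (congrArg z.1 (by ring))⟩
  left_inv z := Subtype.ext <| funext fun i => congrArg z.1 (by ring)
  right_inv z := Subtype.ext <| funext fun i => congrArg z.1 (by ring)
  continuous_toFun := Continuous.subtype_mk
    (continuous_pi fun i => (continuous_apply (A := fun _ : ℤ => X) (i + 1)).comp
      continuous_subtype_val) _
  continuous_invFun := Continuous.subtype_mk
    (continuous_pi fun i => (continuous_apply (A := fun _ : ℤ => X) (i - 1)).comp
      continuous_subtype_val) _

theorem sigmaShiftHomeomorph_apply {X : Type*} [TopologicalSpace X] {f : X → X} {S : Set X}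
    (z : SigmaSet f S) (i : ℤ) : (sigmaShiftHomeomorph f S z).1 i = z.1 (i + 1) := rfl

theorem sigmaShiftHomeomorph_symm_apply {X : Type*} [TopologicalSpace X] {f : X → X} {S : Set X}
    (z : SigmaSet f S) (i : ℤ) : ((sigmaShiftHomeomorph f S).symm z).1 i = z.1 (i - 1) := rfl

theorem sigmaShiftHomeomorph_iterate {X : Type*} [TopologicalSpace X] {f : X → X} {S : Set X}
    (z : SigmaSet f S) (n : ℕ) (i : ℤ) :
    ((sigmaShiftHomeomorph f S)^[n] z).1 i = z.1 (i + n) := by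
  induction n generalizing i with
  | zero => simp
  | succ n ih =>
    rw [Function.iterate_succ_apply', sigmaShiftHomeomorph_apply, ih]
    exact congrArg z.1 (by push_cast; ring)

theorem sigmaShiftHomeomorph_symm_iterate {X : Type*} [TopologicalSpace X] {f : X → X} {S : Set X}
    (z : SigmaSet f S) (n : ℕ) (i : ℤ) :
    ((sigmaShiftHomeomorph f S).symm^[n] z).1 i = z.1 (i - n) := by
  induction n generalizing i with
  | zero => simp
  | succ n ih =>
    rw [Function.iterate_succ_apply', sigmaShiftHomeomorph_symm_apply, ih]
    exact congrArg z.1 (by push_cast; ring)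

theorem isCompact_sigmaSet {X : Type*} [TopologicalSpace X] [T2Space X] {f : X → X}
    (hf : Continuous f) {S : Set X} (hS : IsCompact S) : IsCompact (SigmaSet f S) := by
  have h1 : IsCompact (pi univ fun _ : ℤ => S) := isCompact_univ_pi fun _ => hS
  have h2 : IsClosed {z : ℤ → X | ∀ i, f (z i) = z (i + 1)} := by
    simp only [ofPred_forall]
    exact isClosed_iInter fun i =>
      isClosed_eq (hf.comp (continuous_apply i)) (continuous_apply (i + 1))
  have h3 : SigmaSet f S = (pi univ fun _ : ℤ => S) ∩ {z | ∀ i, f (z i) = z (i + 1)} := by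
    ext z; simp [SigmaSet]
  rw [h3]
  exact h1.inter_right h2

/-- If `f` maps `S` onto itself, every point of `S` is the zeroth term of a bi-infinite orbit. -/
theorem exists_mem_sigmaSet {X : Type*} {f : X → X} {S : Set X} (hmap : MapsTo f S S)
    (hsurj : SurjOn f S S) {x : X} (hx : x ∈ S) : ∃ z ∈ SigmaSet f S, z 0 = x := by
  choose! p hp using fun y (hy : y ∈ S) => hsurj hy
  have hpm : MapsTo p S S := fun y hy => (hp y hy).1
  let z : ℤ → X := fun i => match i with
    | Int.ofNat n => f^[n] x
    | Int.negSucc n => p^[n + 1] x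
  refine ⟨z, ⟨fun i => ?_, fun i => ?_⟩, rfl⟩
  · match i with
    | Int.ofNat n => exact hmap.iterate n hx
    | Int.negSucc n => exact hpm.iterate (n + 1) hx
  · match i with
    | Int.ofNat n => exact (Function.iterate_succ_apply' f n x).symm
    | Int.negSucc 0 => exact (hp x hx).2
    | Int.negSucc (n + 1) =>
      change f (p^[n + 2] x) = p^[n + 1] x
      rw [Function.iterate_succ_apply']
      exact (hp _ (hpm.iterate (n + 1) hx)).2

theorem henon_zero_gmap (c x : ℂ) : henon c 0 (gmap c x) = gmap c (qmap c x) := by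
  simp [henon, gmap, qmap]

theorem mapsTo_henon_zero {c : ℂ} {Λ : Set ℂ} (hinv : Invariant (qmap c) Λ) :
    MapsTo (henon c 0) (gmap c '' Λ) (gmap c '' Λ) := by
  rintro _ ⟨x, hx, rfl⟩
  rw [← hinv] at hx
  exact ⟨qmap c x, hx, (henon_zero_gmap c x).symm⟩

theorem surjOn_henon_zero {c : ℂ} {Λ : Set ℂ} (hinv : Invariant (qmap c) Λ) :
    SurjOn (henon c 0) (gmap c '' Λ) (gmap c '' Λ) := by
  rintro _ ⟨x, hx, rfl⟩
  obtain ⟨y, hy⟩ := IsAlgClosed.exists_pow_nat_eq (x - c) two_pos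
  have hq : qmap c y = x := by simp [qmap, hy]
  have hy' : y ∈ qmap c ⁻¹' Λ := by rwa [mem_preimage, hq]
  rw [hinv] at hy'
  exact ⟨gmap c y, ⟨y, hy', rfl⟩, by rw [henon_zero_gmap, hq]⟩

theorem snd_mem_of_sigmaSet {c : ℂ} {Λ : Set ℂ} {z : ℤ → ℂ × ℂ}
    (hz : z ∈ SigmaSet (henon c 0) (gmap c '' Λ)) (i : ℤ) :
    (z i).2 ∈ Λ ∧ z i = gmap c (z i).2 := by
  obtain ⟨x, hx, h⟩ := hz.1 i
  rw [← h]
  exact ⟨hx, rfl⟩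

/-- The space of bi-infinite orbits over an expanding set, as an expanding model. -/
theorem exists_expandingModel {c : ℂ} {Λ : Set ℂ} (hcomp : IsCompact Λ)
    (hexp : IsExpandingOn (qmap c) Λ) :
    ∃ D : ExpandingModel (SigmaSet (henon c 0) (gmap c '' Λ)) c,
      D.σ = sigmaShiftHomeomorph (henon c 0) (gmap c '' Λ) ∧ ∀ z, D.a z = (z.1 0).2 := by
  obtain ⟨w, ν, M, hν, hM, hw1, hwM, hw⟩ := exists_adapted_weight hcomp hexp
  obtain ⟨R, hR⟩ := hcomp.exists_bound_of_continuousOn (f := fun x : ℂ => x) continuousOn_id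
  obtain ⟨C, hC, lam, hlam, hexp⟩ := hexp
  have hnext : ∀ (z : SigmaSet (henon c 0) (gmap c '' Λ)) (i : ℤ),
      (z.1 (i + 1)).2 = qmap c (z.1 i).2 := fun z i => by
    rw [← z.2.2 i, (snd_mem_of_sigmaSet z.2 i).2]; simp [henon, gmap]
  have hmem : ∀ z : SigmaSet (henon c 0) (gmap c '' Λ), (z.1 0).2 ∈ Λ := fun z =>
    (snd_mem_of_sigmaSet z.2 0).1
  refine ⟨{
    σ := sigmaShiftHomeomorph (henon c 0) (gmap c '' Λ)
    a := fun z => (z.1 0).2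
    w := fun z => w (z.1 0).2
    ν := ν
    M := M
    m := C * lam
    R := max R 0
    continuous_a := continuous_snd.comp ((continuous_apply 0).comp continuous_subtype_val)
    one_lt_ν := hν
    one_le_M := hM
    m_pos := by positivity
    R_nonneg := le_max_right _ _
    one_le_w := fun z => hw1 _
    w_le := fun z => hwM _ (hmem z)
    le_norm := fun z => by
      have h1 := hexp _ (hmem z) 1 le_rfl
      rwa [Function.iterate_one, (hasDerivAt_qmap c _).deriv, pow_one] at h1
    norm_le := fun z => (hR _ (hmem z)).trans (le_max_left _ _)
    expand := fun z => by
      have h := hw _ (hmem z)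
      rw [← hnext z 0, zero_add] at h
      rwa [sigmaShiftHomeomorph_apply, zero_add]
    orbit := fun z => by
      rw [sigmaShiftHomeomorph_apply, hnext]
      rfl
    separates := fun z z' h1 h2 => by
      refine Subtype.ext (funext fun i => ?_)
      rw [(snd_mem_of_sigmaSet z.2 i).2, (snd_mem_of_sigmaSet z'.2 i).2]
      congr 1
      obtain ⟨n, rfl | rfl⟩ := i.eq_nat_or_neg
      · simpa only [sigmaShiftHomeomorph_iterate, zero_add] using h1 n
      · simpa only [sigmaShiftHomeomorph_symm_iterate, zero_sub] using h2 n }, rfl, fun _ => rfl⟩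

/-- A family of injections of `X` into `ℂ²` depending holomorphically on the parameter induces a
holomorphic motion of each member that is an embedding. -/
theorem exists_isHolomorphicMotion {X : Type*} [TopologicalSpace X] {D : Set ℂ} {b₀ : ℂ}
    {F : ℂ → X → ℂ × ℂ} (hemb : IsEmbedding (F b₀)) (hinj : ∀ b ∈ D, Function.Injective (F b))
    (hcont : ContinuousOn (fun p : ℂ × X => F p.1 p.2) (D ×ˢ univ))
    (hdiff : ∀ x, DifferentiableOn ℂ (fun b => F b x) D) :
    ∃ Θ : ℂ → ℂ × ℂ → ℂ × ℂ, IsHolomorphicMotion D b₀ (range (F b₀)) Θ ∧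
      ∀ b x, Θ b (F b₀ x) = F b x := by
  rcases isEmpty_or_nonempty X with hX | ⟨⟨x₀⟩⟩
  · exact ⟨fun _ w => w, by simp [IsHolomorphicMotion, range_eq_empty], fun _ x => hX.elim x⟩
  set ψ : ℂ × ℂ → X := Function.extend (F b₀) id fun _ => x₀
  have hψ : ∀ x, ψ (F b₀ x) = x := fun x => hemb.injective.extend_apply _ _ x
  have hψc : ContinuousOn ψ (range (F b₀)) := hemb.continuousOn_extend continuous_id _
  refine ⟨fun b w => F b (ψ w), ⟨?_, ?_, ?_, fun w _ => hdiff (ψ w)⟩, fun b x => ?_⟩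
  · exact hcont.comp (f := fun p : ℂ × (ℂ × ℂ) => (p.1, ψ p.2))
      (continuousOn_fst.prodMk (hψc.comp continuousOn_snd fun p hp => hp.2))
      fun p hp => ⟨hp.1, mem_univ _⟩
  · rintro _ ⟨x, rfl⟩
    exact congrArg _ (hψ x)
  · rintro b hb _ ⟨x, rfl⟩ _ ⟨y, rfl⟩ h
    beta_reduce at h
    rw [hψ, hψ] at h
    rw [hinj b hb h]
  · exact congrArg _ (hψ x)

/-- The data `ε₀`, `A_b`, `Φ_b` of the main conjugacy theorem can be chosen so that
(a) for each base point `b₀` with `0 < |b₀| < ε₀` the family `Θ(b, Φ_{b₀}(w)) = Φ_b(w)`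
is a holomorphic motion of `A_{b₀}` over the punctured disc, and
(b) `A_b → A` in the Hausdorff distance as `b → 0`. -/
theorem shadowing_conjugacy_holomorphic_motion (c : ℂ) (Λ : Set ℂ) (hcomp : IsCompact Λ)
    (hinv : Invariant (qmap c) Λ) (hexp : IsExpandingOn (qmap c) Λ) :
    ∃ ε₀ > 0, ∃ Ab : ℂ → Set (ℂ × ℂ),
      ∃ Φ : ℂ → (SigmaSet (henon c 0) (gmap c '' Λ)) → ℂ × ℂ,
      (∀ b : ℂ, b ≠ 0 → ‖b‖ < ε₀ →
        IsCompact (Ab b) ∧ Invariant (henon c b) (Ab b) ∧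
        IsHyperbolicSet (henon c b) (henonInv c b) (Ab b) ∧
        Topology.IsEmbedding (Φ b) ∧ Set.range (Φ b) = Ab b ∧
        ∀ z : SigmaSet (henon c 0) (gmap c '' Λ),
          Φ b (sigmaShift (henon c 0) (gmap c '' Λ) z) = henon c b (Φ b z)) ∧
      (∀ b₀ : ℂ, b₀ ≠ 0 → ‖b₀‖ < ε₀ →
        ∃ Θ : ℂ → ℂ × ℂ → ℂ × ℂ,
          IsHolomorphicMotion {b : ℂ | b ≠ 0 ∧ ‖b‖ < ε₀} b₀ (Ab b₀) Θ ∧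
          ∀ b : ℂ, b ≠ 0 → ‖b‖ < ε₀ →
            ∀ z : SigmaSet (henon c 0) (gmap c '' Λ), Θ b (Φ b₀ z) = Φ b z) ∧
      Filter.Tendsto (fun b => Metric.hausdorffDist (Ab b) (gmap c '' Λ))
        (nhdsWithin 0 {b : ℂ | b ≠ 0}) (nhds 0) := by
  have hH : Differentiable ℂ (henon c 0) := differentiable_henon c 0
  have hg : Continuous (gmap c) := by unfold gmap qmap; fun_prop
  have hXc := isCompact_sigmaSet hH.continuous (hcomp.image hg)
  have : CompactSpace (SigmaSet (henon c 0) (gmap c '' Λ)) := isCompact_iff_compactSpace.1 hXc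
  obtain ⟨D, hDσ, hDa⟩ := exists_expandingModel hcomp hexp
  have hm := D.m_pos
  have hν := D.one_lt_ν
  have hM := D.one_le_M
  obtain ⟨L, hL, hshadow⟩ := D.exists_shadowing
  obtain ⟨η, ⟨⟨hη2, hηm⟩, hηM⟩, hη⟩ : ∃ η : ℝ, ((η * 1 ≤ 1 / 2 ∧ η * 1 ≤ D.m / 8) ∧
      η * D.M ≤ (D.ν - 1) / 4) ∧ 0 < η :=
    ((((eventually_mul_le_nhdsGT_zero 1 one_half_pos).and
      (eventually_mul_le_nhdsGT_zero 1 (by positivity))).and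
      (eventually_mul_le_nhdsGT_zero D.M (by linarith))).and self_mem_nhdsWithin).exists
  have hθ : D.ν⁻¹ < 1 := inv_lt_one_of_one_lt₀ hν
  obtain ⟨ε, ⟨⟨⟨⟨⟨⟨u, huc, hud, hub, hueq⟩, hε1⟩, hε2⟩, hε3⟩, hε4⟩, hε5⟩, hε⟩ :=
    ((((((hshadow.and
      (eventually_mul_le_nhdsGT_zero (2 * L / D.m) (r := (1 - D.ν⁻¹) / 2) (by linarith))).and
      (eventually_mul_le_nhdsGT_zero (D.M * (2 * L)) (r := (D.ν - 1) / 4) (by linarith))).and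
      (eventually_mul_le_nhdsGT_zero (2 * L) (half_pos hm))).and
      (eventually_mul_le_nhdsGT_zero (D.m / 4)⁻¹ hη)).and
      (eventually_mul_le_nhdsGT_zero ((D.m / 4) ^ 2)⁻¹ one_half_pos)).and
      self_mem_nhdsWithin).exists
  replace hε : 0 < ε := hε
  set Y : ℂ → SigmaSet (henon c 0) (gmap c '' Λ) → ℂ := fun b x => D.a x + u (b, x) with hY
  set Φ : ℂ → SigmaSet (henon c 0) (gmap c '' Λ) → ℂ × ℂ :=
    fun b x => (Y b (D.σ x), Y b x) with hΦ
  have hball : ∀ b : ℂ, ‖b‖ < ε → b ∈ ball (0 : ℂ) ε := fun b hb => by simpa using hb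
  have hYc : ContinuousOn (fun p : ℂ × SigmaSet (henon c 0) (gmap c '' Λ) => Y p.1 p.2)
      (ball 0 ε ×ˢ univ) := (D.continuous_a.comp continuous_snd).continuousOn.add huc
  have hΦc : ContinuousOn (fun p : ℂ × SigmaSet (henon c 0) (gmap c '' Λ) => Φ p.1 p.2)
      (ball 0 ε ×ˢ univ) := by
    refine ContinuousOn.prodMk ?_ hYc
    exact hYc.comp (f := fun p : ℂ × SigmaSet (henon c 0) (gmap c '' Λ) => (p.1, D.σ p.2))
      (continuous_fst.prodMk (D.σ.continuous.comp continuous_snd)).continuousOn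
      fun p hp => ⟨hp.1, mem_univ _⟩
  have hYb : ∀ b, ‖b‖ < ε → Continuous (Y b) := fun b hb =>
    hYc.comp_continuous (Continuous.prodMk_right b) fun x => ⟨hball b hb, mem_univ _⟩
  have hYa' : ∀ b, ‖b‖ < ε → ∀ x, ‖Y b x - D.a x‖ ≤ L * ‖b‖ := fun b hb x => by
    rw [hY, add_sub_cancel_left]
    exact hub b (hball b hb) x
  have hYa : ∀ b, ‖b‖ < ε → ∀ x, ‖Y b x - D.a x‖ ≤ L * ε := fun b hb x =>
    (hYa' b hb x).trans (by gcongr)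
  have hYeq : ∀ b, ‖b‖ < ε → ∀ x, Y b (D.σ x) = Y b x ^ 2 + c - b * Y b (D.σ.symm x) :=
    fun b hb => hueq b (hball b hb)
  have hinj : ∀ b, b ≠ 0 → ‖b‖ < ε → Function.Injective (Φ b) := fun b hb0 hb =>
    D.injective_of_shadowing hb0 (le_of_eq_of_le (by ring) hε1) (hYa b hb) (hYeq b hb)
  have hΦb : ∀ b, ‖b‖ < ε → Continuous (Φ b) := fun b hb =>
    ((hYb b hb).comp D.σ.continuous).prodMk (hYb b hb)
  have hemb : ∀ b, b ≠ 0 → ‖b‖ < ε → IsEmbedding (Φ b) := fun b hb0 hb =>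
    ((hΦb b hb).isClosedEmbedding (hinj b hb0 hb)).isEmbedding
  have hconj : ∀ b, ‖b‖ < ε → ∀ x, Φ b (D.σ x) = henon c b (Φ b x) := fun b hb x => by
    ext
    · simp [hΦ, henon, hYeq b hb (D.σ x)]
    · simp [hΦ, henon]
  refine ⟨ε, hε, fun b => range (Φ b), Φ, fun b hb0 hb => ⟨isCompact_range (hΦb b hb), ?_, ?_,
    hemb b hb0 hb, rfl, fun z => ?_⟩, fun b₀ hb₀ hb₀ε => ?_, ?_⟩
  · ext p
    constructor
    · rintro ⟨x, hx⟩
      refine ⟨D.σ.symm x, ?_⟩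
      rw [← D.σ.apply_symm_apply x, hconj b hb] at hx
      rw [← henonInv_henon hb0 c (Φ b _), hx, henonInv_henon hb0]
    · rintro ⟨x, rfl⟩
      exact ⟨D.σ x, hconj b hb x⟩
  · refine D.isHyperbolicSet_of_shadowing (hYb b hb) (ρ := L * ε) (η := η) hb0 (hYa b hb)
      (hYeq b hb) (hemb b hb0 hb) hη.le (by linarith) (by linarith) (by linarith) (by linarith)
      ?_ ?_
    · refine le_trans ?_ hε4
      rw [div_eq_mul_inv]
      gcongr
    · refine le_trans ?_ hε5
      rw [div_eq_mul_inv]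
      gcongr
  · rw [← hconj b hb, hDσ]
    rfl
  · obtain ⟨Θ, h1, h2⟩ := exists_isHolomorphicMotion (D := {b : ℂ | b ≠ 0 ∧ ‖b‖ < ε}) (F := Φ)
      (hemb b₀ hb₀ hb₀ε) (fun b hb => hinj b hb.1 hb.2)
      (hΦc.mono (prod_mono_left fun b hb => hball b hb.2))
      (fun x => (((differentiableOn_const _).add (hud _)).prodMk
        ((differentiableOn_const _).add (hud _))).mono fun b hb => hball b hb.2)
    exact ⟨Θ, h1, fun b _ _ z => h2 b z⟩
  · have hdist : ∀ b, ‖b‖ < ε → ∀ x, dist (Φ b x) (gmap c (D.a x)) ≤ L * ‖b‖ := by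
      intro b hb x
      rw [dist_eq_norm, Prod.norm_def]
      refine max_le ?_ (hYa' b hb x)
      have := hYa' b hb (D.σ x)
      rwa [D.orbit] at this
    have hlim : Tendsto (fun b : ℂ => L * ‖b‖) (𝓝[{b : ℂ | b ≠ 0}] 0) (𝓝 0) := by
      have : Tendsto (fun b : ℂ => L * ‖b‖) (𝓝 0) (𝓝 (L * ‖(0 : ℂ)‖)) :=
        (continuous_const.mul continuous_norm).tendsto 0
      rw [norm_zero, mul_zero] at this
      exact this.mono_left nhdsWithin_le_nhds
    refine squeeze_zero' (Eventually.of_forall fun _ => hausdorffDist_nonneg) ?_ hlim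
    filter_upwards [mem_nhdsWithin_of_mem_nhds (ball_mem_nhds (0 : ℂ) hε)] with b hb
    replace hb : ‖b‖ < ε := by simpa using hb
    refine hausdorffDist_le_of_mem_dist (by positivity) ?_ ?_
    · rintro _ ⟨x, rfl⟩
      refine ⟨gmap c (D.a x), ⟨D.a x, ?_, rfl⟩, hdist b hb x⟩
      rw [hDa]
      exact (snd_mem_of_sigmaSet x.2 0).1
    · rintro y hy
      obtain ⟨z, hz, hz0⟩ := exists_mem_sigmaSet (mapsTo_henon_zero hinv)
        (surjOn_henon_zero hinv) hy
      refine ⟨Φ b ⟨z, hz⟩, mem_range_self _, ?_⟩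
      rw [dist_comm]
      have h := hdist b hb ⟨z, hz⟩
      rwa [hDa, ← (snd_mem_of_sigmaSet hz 0).2, hz0] at h
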